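/- arXiv:2102.07976 — 2 statements merged into one kernel-verified Lean document; each statement's English description precedes it below -/
import Mathlib

section
/- Let X ⊆ ℝⁿ be compact. Let F, f : ℝⁿ × ℝᵐ → ℝ be such that F, ∇_y F, f, ∇_y f are continuous on X × ℝᵐ, and for every x ∈ X, F(x,·) is convex, L_F-smooth and bounded below by M₀, and f(x,·) is convex and L_f-smooth. Assume f is level-bounded in y uniformly in x ∈ X, i.e. for every r ∈ ℝ the set { y ∈ ℝᵐ : ∃ x ∈ X, f(x,y) ≤ r } is bounded, and assume that for every x ∈ X the set Ŝ(x) := argmin { F(x,y) : y ∈ S(x) } is nonempty, where S(x) := argmin_{y∈ℝᵐ} f(x,y). Fix y₀ ∈ ℝᵐ, s = s_u = s_l ∈ (0, 1/max(L_F, L_f)), μ ∈ (0,1), α_k = 1/(k+1), and β_k ∈ [β̲, 1] with β̲ > 0, β_k ≤ β_{k−1}, and |β_k − β_{k−1}| ≤ c_β/(k+1)² for some c_β > 0, and define y_{k+1}(x) = y_k(x) − s( α_k μ ∇_y F(x, y_k(x)) + β_k (1−μ) ∇_y f(x, y_k(x)) ) with y₀(x) = y₀. Then, with φ(x) := inf_{y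 ∈ S(x)} F(x,y) and f*(x) := min_{y∈ℝᵐ} f(x,y): (UL) for every x ∈ X, F(x, y_K(x)) → φ(x) as K → ∞; (LL) the family {y_K(x) : K ∈ ℕ, x ∈ X} is bounded, and sup_{x∈X} ( f(x, y_K(x)) − f*(x) ) → 0 as K → ∞. -/
open Filter Topology Set Metric

section GradientStep

variable {E : Type*} [NormedAddCommGroup E] [InnerProductSpace ℝ E] [CompleteSpace E]

theorem HasGradientAt.hasDerivAt_comp_line {g : E → ℝ} {g' a d : E} {t : ℝ}
    (h : HasGradientAt g g' (a + t • d)) :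
    HasDerivAt (fun t : ℝ => g (a + t • d)) (inner ℝ g' d) t := by
  have hline : HasDerivAt (fun t : ℝ => a + t • d) d t := by
    simpa using ((hasDerivAt_id t).smul_const d).const_add a
  simpa [Function.comp_def] using h.hasFDerivAt.comp_hasDerivAt t hline

theorem ConvexOn.add_inner_le_of_hasGradientAt {g : E → ℝ} {g' a : E}
    (hg : ConvexOn ℝ univ g) (h : HasGradientAt g g' a) (b : E) :
    g a + inner ℝ g' (b - a) ≤ g b := by
  have hline : ConvexOn ℝ univ (fun t : ℝ => g (a + t • (b - a))) := by
    have := hg.comp_affineMap (AffineMap.lineMap a b : ℝ →ᵃ[ℝ] E)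
    simpa [Function.comp_def, AffineMap.lineMap_apply, add_comm] using this
  have hderiv : HasDerivAt (fun t : ℝ => g (a + t • (b - a))) (inner ℝ g' (b - a)) 0 :=
    HasGradientAt.hasDerivAt_comp_line (by simpa using h)
  have := hline.le_slope_of_hasDerivAt (mem_univ 0) (mem_univ 1) one_pos hderiv
  simp [slope_def_field] at this
  linarith

/-- The descent lemma for functions with Lipschitz gradient. -/
theorem le_add_inner_add_of_lipschitz_gradient {g : E → ℝ} {g' : E → E} {L : ℝ}
    (hg : ∀ w, HasGradientAt g (g' w) w) (hL : ∀ v w, ‖g' v - g' w‖ ≤ L * ‖v - w‖) (a b : E) :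
    g b ≤ g a + inner ℝ (g' a) (b - a) + L / 2 * ‖b - a‖ ^ 2 := by
  set d := b - a with hd
  have hderiv : ∀ t : ℝ, HasDerivAt
      (fun t : ℝ => g (a + t • d) - (t * inner ℝ (g' a) d + L / 2 * ‖d‖ ^ 2 * t ^ 2))
      (inner ℝ (g' (a + t • d)) d - (inner ℝ (g' a) d + L * ‖d‖ ^ 2 * t)) t := by
    intro t
    have h := (hg (a + t • d)).hasDerivAt_comp_line.sub
      (((hasDerivAt_id t).mul_const (inner ℝ (g' a) d)).add
        ((hasDerivAt_pow 2 t).const_mul (L / 2 * ‖d‖ ^ 2)))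
    refine h.congr_deriv ?_
    simp
    ring
  have hanti := antitoneOn_of_deriv_nonpos (convex_Icc (0 : ℝ) 1)
    (fun t _ => (hderiv t).continuousAt.continuousWithinAt)
    (fun t _ => (hderiv t).differentiableAt.differentiableWithinAt)
    (by
      intro t ht
      rw [interior_Icc] at ht
      rw [(hderiv t).deriv]
      have h1 : inner ℝ (g' (a + t • d) - g' a) d ≤ L * ‖d‖ ^ 2 * t := by
        calc inner ℝ (g' (a + t • d) - g' a) d
            ≤ ‖g' (a + t • d) - g' a‖ * ‖d‖ := real_inner_le_norm _ _
          _ ≤ L * ‖a + t • d - a‖ * ‖d‖ := by gcongr; exact hL _ _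
          _ = L * ‖d‖ ^ 2 * t := by
            rw [add_sub_cancel_left, norm_smul, Real.norm_of_nonneg ht.1.le]; ring
      rw [inner_sub_left] at h1
      linarith)
  have := hanti (left_mem_Icc.2 zero_le_one) (right_mem_Icc.2 zero_le_one) zero_le_one
  simp only [one_smul, zero_smul, add_zero, hd, add_sub_cancel] at this
  linarith

theorem gradient_step_le {g : E → ℝ} {g' : E → E} {L s : ℝ} (hconv : ConvexOn ℝ univ g)
    (hg : ∀ w, HasGradientAt g (g' w) w) (hL : ∀ v w, ‖g' v - g' w‖ ≤ L * ‖v - w‖)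
    (hs : 0 < s) (hsL : s * L ≤ 1) (v p : E) :
    2 * s * (g (v - s • g' v) - g p) ≤ ‖v - p‖ ^ 2 - ‖v - s • g' v - p‖ ^ 2 := by
  have h1 := le_add_inner_add_of_lipschitz_gradient hg hL v (v - s • g' v)
  have h2 := hconv.add_inner_le_of_hasGradientAt (hg v) p
  have h3 : ‖v - s • g' v - p‖ ^ 2
      = ‖v - p‖ ^ 2 - 2 * s * inner ℝ (g' v) (v - p) + s ^ 2 * ‖g' v‖ ^ 2 := by
    rw [sub_right_comm, norm_sub_sq_real, inner_smul_right, norm_smul, mul_pow, real_inner_comm,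
      Real.norm_eq_abs, sq_abs]
    ring
  have h4 : inner ℝ (g' v) (p - v) = - inner ℝ (g' v) (v - p) := by
    rw [← inner_neg_right, neg_sub]
  have h5 : v - s • g' v - v = -(s • g' v) := by abel
  rw [h5, inner_neg_right, inner_smul_right, real_inner_self_eq_norm_sq, norm_neg, norm_smul,
    mul_pow, Real.norm_eq_abs, sq_abs] at h1
  have h6 : s * L * (s ^ 2 * ‖g' v‖ ^ 2) ≤ 1 * (s ^ 2 * ‖g' v‖ ^ 2) := by gcongr
  rw [h3]
  rw [h4] at h2
  nlinarith [mul_le_mul_of_nonneg_left h1 hs.le, mul_le_mul_of_nonneg_left h2 hs.le]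

theorem gradient_step_add_le {F f : E → ℝ} {F' f' : E → E} {LF Lf s a b : ℝ}
    (hF : ConvexOn ℝ univ F) (hf : ConvexOn ℝ univ f)
    (hF' : ∀ w, HasGradientAt F (F' w) w) (hf' : ∀ w, HasGradientAt f (f' w) w)
    (hLF : ∀ v w, ‖F' v - F' w‖ ≤ LF * ‖v - w‖) (hLf : ∀ v w, ‖f' v - f' w‖ ≤ Lf * ‖v - w‖)
    (hs : 0 < s) (ha : 0 ≤ a) (hb : 0 ≤ b) (hsL : s * (a * LF + b * Lf) ≤ 1) (v p : E) :
    2 * s * (a * (F (v - ((a * s) • F' v + (b * s) • f' v)) - F p)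
      + b * (f (v - ((a * s) • F' v + (b * s) • f' v)) - f p))
      ≤ ‖v - p‖ ^ 2 - ‖v - ((a * s) • F' v + (b * s) • f' v) - p‖ ^ 2 := by
  have h := gradient_step_le (g := fun w => a * F w + b * f w)
    (g' := fun w => a • F' w + b • f' w) (L := a * LF + b * Lf) (s := s)
    ((hF.smul ha).add (hf.smul hb))
    (fun w => by
      rw [hasGradientAt_iff_hasFDerivAt, map_add, map_smulₛₗ, map_smulₛₗ]
      exact ((hF' w).hasFDerivAt.const_mul a).add ((hf' w).hasFDerivAt.const_mul b))
    (fun v w => by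
      calc ‖a • F' v + b • f' v - (a • F' w + b • f' w)‖
          = ‖a • (F' v - F' w) + b • (f' v - f' w)‖ := by congr 1; module
        _ ≤ ‖a • (F' v - F' w)‖ + ‖b • (f' v - f' w)‖ := norm_add_le _ _
        _ = a * ‖F' v - F' w‖ + b * ‖f' v - f' w‖ := by
          rw [norm_smul, norm_smul, Real.norm_of_nonneg ha, Real.norm_of_nonneg hb]
        _ ≤ a * (LF * ‖v - w‖) + b * (Lf * ‖v - w‖) := by gcongr <;> apply_assumption
        _ = (a * LF + b * Lf) * ‖v - w‖ := by ring)
    hs hsL v p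
  have hstep : v - s • (a • F' v + b • f' v) = v - ((a * s) • F' v + (b * s) • f' v) := by
    module
  simp only [hstep] at h
  convert h using 1
  ring

end GradientStep

section Energy

variable {E : Type*} [NormedAddCommGroup E] {F f : E → ℝ} {u : ℕ → E} {a b : ℕ → ℝ} {c M v : ℝ}

theorem energy_antitone
    (hstep : ∀ k p, c * (a k * (F (u (k + 1)) - F p) + b k * (f (u (k + 1)) - f p))
      ≤ ‖u k - p‖ ^ 2 - ‖u (k + 1) - p‖ ^ 2)
    (hc : 0 < c) (ha : Antitone a) (hb : Antitone b) (hF : ∀ w, M ≤ F w) (hf : ∀ w, v ≤ f w) :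
    Antitone (fun k => a k * (F (u k) - M) + b k * (f (u k) - v)) := by
  refine antitone_nat_of_succ_le fun k => ?_
  have h1 := hstep k (u k)
  have h2 : a k * (F (u (k + 1)) - F (u k)) + b k * (f (u (k + 1)) - f (u k)) ≤ 0 := by
    rw [sub_self, norm_zero] at h1
    by_contra! h
    nlinarith [mul_pos hc h, sq_nonneg ‖u (k + 1) - u k‖]
  have h3 := mul_le_mul_of_nonneg_right (ha k.le_succ) (sub_nonneg.2 (hF (u (k + 1))))
  have h4 := mul_le_mul_of_nonneg_right (hb k.le_succ) (sub_nonneg.2 (hf (u (k + 1))))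
  simp only [Nat.succ_eq_add_one] at h3 h4
  linarith

theorem natCast_mul_energy_le
    (hstep : ∀ k p, c * (a k * (F (u (k + 1)) - F p) + b k * (f (u (k + 1)) - f p))
      ≤ ‖u k - p‖ ^ 2 - ‖u (k + 1) - p‖ ^ 2)
    (hc : 0 < c) (ha : Antitone a) (hb : Antitone b) (hF : ∀ w, M ≤ F w) (hf : ∀ w, v ≤ f w)
    {p : E} (hp : f p = v) (K : ℕ) :
    c * (K * (a K * (F (u K) - M) + b K * (f (u K) - v)))
      ≤ ‖u 0 - p‖ ^ 2 + c * ((F p - M) * ∑ k ∈ Finset.range K, a k) := by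
  have hanti := energy_antitone hstep hc ha hb hF hf
  suffices h : ∀ K : ℕ, c * (K * (a K * (F (u K) - M) + b K * (f (u K) - v))) + ‖u K - p‖ ^ 2
      ≤ ‖u 0 - p‖ ^ 2 + c * ((F p - M) * ∑ k ∈ Finset.range K, a k) by
    linarith [h K, sq_nonneg ‖u K - p‖]
  intro K
  induction K with
  | zero => simp
  | succ K ih =>
    have h1 := hstep K p
    have h2 := mul_le_mul_of_nonneg_right (ha K.le_succ) (sub_nonneg.2 (hF (u (K + 1))))
    have h3 := mul_le_mul_of_nonneg_right (hb K.le_succ) (sub_nonneg.2 (hf (u (K + 1))))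
    have h4 := mul_le_mul_of_nonneg_left (hanti K.le_succ) (mul_nonneg hc.le K.cast_nonneg)
    have h5 := mul_le_mul_of_nonneg_left (add_le_add h2 h3) hc.le
    simp only [Nat.succ_eq_add_one] at h4 h5
    rw [Finset.sum_range_succ]
    push_cast
    rw [hp] at h1
    linarith

end Energy

section Convergence

variable {E : Type*} [NormedAddCommGroup E] [ProperSpace E] {F f : E → ℝ} {u : ℕ → E}
  {a b : ℕ → ℝ} {c C v φ : ℝ} {T : Set E}

theorem exists_subseq_tendsto_mem_of_minimizing
    (hfc : Continuous f) (hFc : Continuous F)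
    (hu : ∀ k, ‖u k‖ ≤ C) (hfu : Tendsto (fun k => f (u k)) atTop (𝓝 v))
    (hT : ∀ w, f w = v → F w ≤ φ → w ∈ T) {ns : ℕ → ℕ} (hns : Tendsto ns atTop atTop) :
    ∃ w, ∃ ms : ℕ → ℕ, StrictMono ms ∧ Tendsto (fun k => u (ns (ms k))) atTop (𝓝 w) ∧
      f w = v ∧ Tendsto (fun k => F (u (ns (ms k)))) atTop (𝓝 (F w)) ∧ (F w ≤ φ → w ∈ T) := by
  obtain ⟨w, -, ms, hms, hw⟩ := tendsto_subseq_of_bounded (isBounded_closedBall (x := (0 : E)))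
    (x := fun k => u (ns k)) (fun k => mem_closedBall_zero_iff.2 (hu _))
  have hfw : f w = v := tendsto_nhds_unique ((hfc.tendsto w).comp hw)
    (hfu.comp (hns.comp hms.tendsto_atTop))
  exact ⟨w, ms, hms, hw, hfw, (hFc.tendsto w).comp hw, hT w hfw⟩

theorem exists_forall_add_le_of_le_infDist
    (hfc : Continuous f) (hFc : Continuous F)
    (hu : ∀ k, ‖u k‖ ≤ C) (hfu : Tendsto (fun k => f (u k)) atTop (𝓝 v))
    (hT : ∀ w, f w = v → F w ≤ φ → w ∈ T) {ε : ℝ} (hε : 0 < ε) :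
    ∃ η > 0, ∃ N, ∀ k ≥ N, ε ≤ infDist (u k) T → φ + η ≤ F (u k) := by
  by_contra! H
  have hpos : ∀ n : ℕ, (0 : ℝ) < 1 / ((n : ℝ) + 1) := fun n => Nat.one_div_pos_of_nat
  choose ns hns hdist hF using fun n : ℕ => H _ (hpos n) n
  obtain ⟨w, ms, hms, hw, -, hFw, hwT⟩ := exists_subseq_tendsto_mem_of_minimizing
    hfc hFc hu hfu hT (tendsto_atTop_mono hns tendsto_id)
  have hlim : Tendsto (fun k => φ + 1 / ((ms k : ℝ) + 1)) atTop (𝓝 (φ + 0)) :=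
    (tendsto_one_div_add_atTop_nhds_zero_nat.comp hms.tendsto_atTop).const_add φ
  have hmem := hwT (by simpa using le_of_tendsto_of_tendsto' hFw hlim fun k => (hF _).le)
  have hd : Tendsto (fun k => infDist (u (ns (ms k))) T) atTop (𝓝 (infDist w T)) :=
    ((continuous_infDist_pt T).tendsto w).comp hw
  have := ge_of_tendsto' hd fun k => hdist _
  rw [infDist_zero_of_mem hmem] at this
  linarith

theorem tendsto_infDist_zero
    (hstep : ∀ k p, c * (a k * (F (u (k + 1)) - F p) + b k * (f (u (k + 1)) - f p))
      ≤ ‖u k - p‖ ^ 2 - ‖u (k + 1) - p‖ ^ 2)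
    (hc : 0 < c) (ha : ∀ k, 0 ≤ a k) (hb : ∀ k, 0 ≤ b k)
    (hsum : Tendsto (fun K => ∑ k ∈ Finset.range K, a k) atTop atTop)
    (hfc : Continuous f) (hFc : Continuous F) (hf : ∀ w, v ≤ f w)
    (hu : ∀ k, ‖u k‖ ≤ C) (hfu : Tendsto (fun k => f (u k)) atTop (𝓝 v))
    (hT : ∀ w, w ∈ T ↔ f w = v ∧ F w ≤ φ) (hTF : ∀ w ∈ T, F w = φ)
    (hTne : T.Nonempty) (hTc : IsClosed T) :
    Tendsto (fun k => infDist (u k) T) atTop (𝓝 0) := by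
  have hdec : ∀ k, infDist (u (k + 1)) T ^ 2
      ≤ infDist (u k) T ^ 2 - c * (a k * (F (u (k + 1)) - φ)) := by
    intro k
    obtain ⟨p, hp, hpd⟩ := hTc.exists_infDist_eq_dist hTne (u k)
    have h1 := hstep k p
    have h2 : infDist (u (k + 1)) T ^ 2 ≤ ‖u (k + 1) - p‖ ^ 2 := by
      rw [← dist_eq_norm]
      exact pow_le_pow_left₀ infDist_nonneg (infDist_le_dist_of_mem hp) 2
    rw [hpd, dist_eq_norm]
    rw [hTF p hp, ((hT p).1 hp).1] at h1
    nlinarith [mul_nonneg hc.le (mul_nonneg (hb k) (sub_nonneg.2 (hf (u (k + 1)))))]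
  rw [Metric.tendsto_atTop]
  intro ε hε
  obtain ⟨η, hη, N, hN⟩ := exists_forall_add_le_of_le_infDist hfc hFc hu hfu
    (fun w h1 h2 => (hT w).2 ⟨h1, h2⟩) hε
  have hdrop : ∀ k ≥ N, ε ≤ infDist (u (k + 1)) T →
      infDist (u (k + 1)) T ^ 2 + c * η * a k ≤ infDist (u k) T ^ 2 := by
    intro k hk hle
    have h1 := hN (k + 1) (by omega) hle
    have h2 : a k * η ≤ a k * (F (u (k + 1)) - φ) :=
      mul_le_mul_of_nonneg_left (by linarith) (ha k)
    nlinarith [hdec k, mul_le_mul_of_nonneg_left h2 hc.le]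
  obtain ⟨k₀, hk₀, hlt⟩ : ∃ k ≥ N, infDist (u k) T < ε := by
    by_contra! H
    have hbound : ∀ k ≥ N, infDist (u k) T ^ 2 + c * η * ∑ i ∈ Finset.range k, a i
        ≤ infDist (u N) T ^ 2 + c * η * ∑ i ∈ Finset.range N, a i := by
      intro k hk
      induction k, hk using Nat.le_induction with
      | base => exact le_rfl
      | succ k hk ih =>
        rw [Finset.sum_range_succ]
        linarith [hdrop k hk (H _ (by omega))]
    obtain ⟨k, hk, hkN⟩ := ((hsum.const_mul_atTop (mul_pos hc hη)).eventually_gt_atTop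
      (infDist (u N) T ^ 2 + c * η * ∑ i ∈ Finset.range N, a i) |>.and
      (eventually_ge_atTop N)).exists
    linarith [hbound k hkN, sq_nonneg (infDist (u k) T)]
  refine ⟨k₀, fun k hk => ?_⟩
  rw [Real.dist_0_eq_abs, abs_of_nonneg infDist_nonneg]
  induction k, hk using Nat.le_induction with
  | base => exact hlt
  | succ k hk ih =>
    by_contra! hge
    have h1 := hdrop k (by omega) hge
    have h2 := mul_nonneg (mul_pos hc hη).le (ha k)
    have h3 := pow_lt_pow_left₀ (ih.trans_le hge) infDist_nonneg two_ne_zero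
    linarith

theorem tendsto_outer_value
    (hstep : ∀ k p, c * (a k * (F (u (k + 1)) - F p) + b k * (f (u (k + 1)) - f p))
      ≤ ‖u k - p‖ ^ 2 - ‖u (k + 1) - p‖ ^ 2)
    (hc : 0 < c) (ha : ∀ k, 0 ≤ a k) (hb : ∀ k, 0 ≤ b k)
    (hsum : Tendsto (fun K => ∑ k ∈ Finset.range K, a k) atTop atTop)
    (hfc : Continuous f) (hFc : Continuous F)
    (hu : ∀ k, ‖u k‖ ≤ C) {q : E} (hq : ∀ w, f q ≤ f w)
    (hFq : ∀ w, f w = f q → F q ≤ F w)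
    (hfu : Tendsto (fun k => f (u k)) atTop (𝓝 (f q))) :
    Tendsto (fun k => F (u k)) atTop (𝓝 (F q)) := by
  have hTc : IsClosed {w | f w = f q ∧ F w ≤ F q} :=
    (isClosed_eq hfc continuous_const).inter (isClosed_le hFc continuous_const)
  have hTne : {w | f w = f q ∧ F w ≤ F q}.Nonempty := ⟨q, rfl, le_rfl⟩
  have hd := tendsto_infDist_zero (T := {w | f w = f q ∧ F w ≤ F q}) (φ := F q) hstep hc ha hb
    hsum hfc hFc hq hu hfu (fun _ => Iff.rfl) (fun w hw => le_antisymm hw.2 (hFq w hw.1)) hTne hTc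
  refine tendsto_of_subseq_tendsto fun ns hns => ?_
  obtain ⟨w, ms, hms, hw, hfw, hFw, -⟩ := exists_subseq_tendsto_mem_of_minimizing hfc hFc hu hfu
    (T := univ) (φ := 0) (fun _ _ _ => mem_univ _) hns
  have h0 : infDist w {w | f w = f q ∧ F w ≤ F q} = 0 := tendsto_nhds_unique
    (((continuous_infDist_pt _).tendsto w).comp hw) (hd.comp (hns.comp hms.tendsto_atTop))
  have hmem := (hTc.mem_iff_infDist_zero hTne).2 h0
  rw [le_antisymm hmem.2 (hFq w hmem.1)] at hFw
  exact ⟨ms, hFw⟩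

end Convergence

section UniformBounds

variable {P E : Type*} [TopologicalSpace P] [NormedAddCommGroup E] [ProperSpace E]
  {X : Set P} {g : P → E → ℝ}

theorem exists_uniform_abs_le (hX : IsCompact X)
    (hg : ContinuousOn (fun p : P × E => g p.1 p.2) (X ×ˢ univ)) (R : ℝ) :
    ∃ D, ∀ x ∈ X, ∀ w, ‖w‖ ≤ R → |g x w| ≤ D := by
  obtain ⟨D, hD⟩ := (hX.prod (isCompact_closedBall (0 : E) R)).exists_bound_of_continuousOn
    (hg.mono (prod_mono_right (subset_univ _)))
  exact ⟨D, fun x hx w hw => hD (x, w) ⟨hx, mem_closedBall_zero_iff.2 hw⟩⟩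

theorem exists_uniform_lower_bound (hX : IsCompact X)
    (hg : ContinuousOn (fun p : P × E => g p.1 p.2) (X ×ˢ univ))
    (hlevel : ∀ r : ℝ, Bornology.IsBounded {w : E | ∃ x ∈ X, g x w ≤ r}) :
    ∃ D, ∀ x ∈ X, ∀ w, D ≤ g x w := by
  obtain ⟨R, hR⟩ := (hlevel 0).exists_norm_le
  obtain ⟨D, hD⟩ := exists_uniform_abs_le hX hg R
  refine ⟨min (-D) 0, fun x hx w => ?_⟩
  rcases le_total (g x w) 0 with h | h
  · exact (min_le_left _ _).trans (neg_le_of_abs_le (hD x hx w (hR w ⟨x, hx, h⟩)))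
  · exact (min_le_right _ _).trans h

end UniformBounds

theorem stmt9 {n m : ℕ}
    (X : Set (EuclideanSpace ℝ (Fin n))) (hX : IsCompact X)
    (F f : EuclideanSpace ℝ (Fin n) → EuclideanSpace ℝ (Fin m) → ℝ)
    (Fy fy : EuclideanSpace ℝ (Fin n) → EuclideanSpace ℝ (Fin m) → EuclideanSpace ℝ (Fin m))
    (hFgrad : ∀ x w, HasGradientAt (F x) (Fy x w) w)
    (hfgrad : ∀ x w, HasGradientAt (f x) (fy x w) w)
    (hFc : ContinuousOn (fun p : EuclideanSpace ℝ (Fin n) × EuclideanSpace ℝ (Fin m) => F p.1 p.2) (X ×ˢ univ))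
    (hfc : ContinuousOn (fun p : EuclideanSpace ℝ (Fin n) × EuclideanSpace ℝ (Fin m) => f p.1 p.2) (X ×ˢ univ))
    (hFyc : ContinuousOn (fun p : EuclideanSpace ℝ (Fin n) × EuclideanSpace ℝ (Fin m) => Fy p.1 p.2) (X ×ˢ univ))
    (hfyc : ContinuousOn (fun p : EuclideanSpace ℝ (Fin n) × EuclideanSpace ℝ (Fin m) => fy p.1 p.2) (X ×ˢ univ))
    (LF Lf M₀ : ℝ)
    (hFconv : ∀ x ∈ X, ConvexOn ℝ univ (F x))
    (hFlip : ∀ x ∈ X, ∀ a b, ‖Fy x a - Fy x b‖ ≤ LF * ‖a - b‖)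
    (hFbdd : ∀ x ∈ X, ∀ w, M₀ ≤ F x w)
    (hfconv : ∀ x ∈ X, ConvexOn ℝ univ (f x))
    (hflip : ∀ x ∈ X, ∀ a b, ‖fy x a - fy x b‖ ≤ Lf * ‖a - b‖)
    -- f is level-bounded in y uniformly in x ∈ X
    (hlevel : ∀ r : ℝ, Bornology.IsBounded {w : EuclideanSpace ℝ (Fin m) | ∃ x ∈ X, f x w ≤ r})
    (S : EuclideanSpace ℝ (Fin n) → Set (EuclideanSpace ℝ (Fin m)))
    (hS : ∀ x, S x = {w : EuclideanSpace ℝ (Fin m) | ∀ w', f x w ≤ f x w'})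
    (φ : EuclideanSpace ℝ (Fin n) → ℝ) (hφ : ∀ x, φ x = sInf (F x '' S x))
    (fstar : EuclideanSpace ℝ (Fin n) → ℝ) (hfstar : ∀ x, fstar x = ⨅ w, f x w)
    -- nonemptiness of Ŝ(x) = argmin of F(x,·) over S(x)
    (hShat : ∀ x ∈ X, ∃ w ∈ S x, ∀ w' ∈ S x, F x w ≤ F x w')
    (s μ : ℝ)
    (hs : s ∈ Ioo 0 (1 / max LF Lf)) (hμ : μ ∈ Ioo (0 : ℝ) 1)
    (α : ℕ → ℝ) (hα : ∀ k, α k = 1 / ((k : ℝ) + 1))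
    (βlow cβ : ℝ) (hβlow : 0 < βlow) (hcβ : 0 < cβ)
    (β : ℕ → ℝ) (hβ : ∀ k, β k ∈ Icc βlow 1) (hβanti : Antitone β)
    (hβdiff : ∀ k ≥ 1, |β k - β (k - 1)| ≤ cβ / ((k : ℝ) + 1) ^ 2)
    (y₀ : EuclideanSpace ℝ (Fin m))
    (y : ℕ → EuclideanSpace ℝ (Fin n) → EuclideanSpace ℝ (Fin m))
    (hy0 : ∀ x, y 0 x = y₀)
    (hyrec : ∀ k x, y (k + 1) x =
      y k x - ((α k * μ * s) • Fy x (y k x) + (β k * (1 - μ) * s) • fy x (y k x))) :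
    -- (UL) objective convergence property
    (∀ x ∈ X, Tendsto (fun K => F x (y K x)) atTop (𝓝 (φ x))) ∧
    -- (LL) objective convergence property
    (∃ C : ℝ, ∀ K, ∀ x ∈ X, ‖y K x‖ ≤ C) ∧
    (∀ ε > (0 : ℝ), ∃ N : ℕ, ∀ K ≥ N, ∀ x ∈ X, f x (y K x) - fstar x ≤ ε) := by
  obtain ⟨hs0, hs1⟩ := hs
  obtain ⟨hμ0, hμ1⟩ := hμ
  have hLpos : 0 < max LF Lf := one_div_pos.1 (hs0.trans hs1)
  have hsL : s * max LF Lf ≤ 1 := ((lt_div_iff₀ hLpos).1 hs1).le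
  have h2s : 0 < 2 * s := by positivity
  have hα0 : ∀ k, 0 < α k := fun k => by rw [hα]; positivity
  have hα1 : ∀ k, α k ≤ 1 := fun k => by
    rw [hα, div_le_one (by positivity)]; linarith [k.cast_nonneg (α := ℝ)]
  have ha0 : ∀ k, 0 ≤ α k * μ := fun k => (mul_pos (hα0 k) hμ0).le
  have hβ0 : ∀ k, 0 < β k := fun k => hβlow.trans_le (hβ k).1
  have hb0 : ∀ k, 0 ≤ β k * (1 - μ) := fun k => mul_nonneg (hβ0 k).le (by linarith)
  have hαanti : Antitone α := fun i j hij => by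
    rw [hα, hα]
    exact one_div_le_one_div_of_le (by positivity) (by gcongr)
  have haanti : Antitone fun k => α k * μ := fun i j hij =>
    mul_le_mul_of_nonneg_right (hαanti hij) hμ0.le
  have hbanti : Antitone fun k => β k * (1 - μ) := fun i j hij =>
    mul_le_mul_of_nonneg_right (hβanti hij) (by linarith)
  have hstep : ∀ x ∈ X, ∀ k p,
      2 * s * (α k * μ * (F x (y (k + 1) x) - F x p)
        + β k * (1 - μ) * (f x (y (k + 1) x) - f x p))
      ≤ ‖y k x - p‖ ^ 2 - ‖y (k + 1) x - p‖ ^ 2 := by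
    intro x hx k p
    rw [hyrec k x]
    refine gradient_step_add_le (hFconv x hx) (hfconv x hx) (hFgrad x) (hfgrad x) (hFlip x hx)
      (hflip x hx) hs0 (ha0 k) (hb0 k) ?_ _ _
    have h1 := mul_le_mul_of_nonneg_left (le_max_left LF Lf) (ha0 k)
    have h2 := mul_le_mul_of_nonneg_left (le_max_right LF Lf) (hb0 k)
    have h3 : α k * μ + β k * (1 - μ) ≤ 1 := by
      nlinarith [mul_le_mul_of_nonneg_right (hα1 k) hμ0.le,
        mul_le_mul_of_nonneg_right (hβ k).2 (sub_nonneg.2 hμ1.le)]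
    have h4 := mul_le_mul_of_nonneg_right h3 hLpos.le
    calc s * (α k * μ * LF + β k * (1 - μ) * Lf) ≤ s * max LF Lf := by gcongr; linarith
      _ ≤ 1 := hsL
  have hmin : ∀ x, ∀ w ∈ S x, fstar x = f x w := fun x w hw => by
    rw [hS] at hw
    rw [hfstar]
    exact IsLeast.csInf_eq ⟨mem_range_self w, forall_mem_range.2 hw⟩
  choose! q hqS hqmin using hShat
  have hqf : ∀ x ∈ X, ∀ w, f x (q x) ≤ f x w := fun x hx => by
    have := hqS x hx
    rwa [hS] at this
  have hqv : ∀ x ∈ X, f x (q x) = fstar x := fun x hx => (hmin x _ (hqS x hx)).symm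
  have hfstar_le : ∀ x ∈ X, ∀ w, fstar x ≤ f x w := fun x hx w => hqv x hx ▸ hqf x hx w
  -- Uniform bounds at the starting point and at the solutions.
  obtain ⟨A, hA⟩ := exists_uniform_abs_le hX hFc ‖y₀‖
  obtain ⟨B, hB⟩ := exists_uniform_abs_le hX hfc ‖y₀‖
  obtain ⟨D, hD⟩ := exists_uniform_lower_bound hX hfc hlevel
  have hFy₀ : ∀ x ∈ X, F x y₀ ≤ A := fun x hx => (abs_le.1 (hA x hx y₀ le_rfl)).2
  have hfy₀ : ∀ x ∈ X, f x y₀ ≤ B := fun x hx => (abs_le.1 (hB x hx y₀ le_rfl)).2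
  obtain ⟨R, hR⟩ := (hlevel B).exists_norm_le
  have hqR : ∀ x ∈ X, ‖q x‖ ≤ R := fun x hx =>
    hR _ ⟨x, hx, (hqf x hx y₀).trans (hfy₀ x hx)⟩
  obtain ⟨A', hA'⟩ := exists_uniform_abs_le hX hFc R
  have hFq : ∀ x ∈ X, F x (q x) ≤ A' := fun x hx => (abs_le.1 (hA' x hx _ (hqR x hx))).2
  have hγ : 0 < βlow * (1 - μ) := mul_pos hβlow (by linarith)
  have hgap : ∀ k, ∀ x ∈ X, βlow * (1 - μ) * (f x (y k x) - fstar x)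
      ≤ α k * μ * (F x (y k x) - M₀) + β k * (1 - μ) * (f x (y k x) - fstar x) := by
    intro k x hx
    have h1 := mul_nonneg (ha0 k) (sub_nonneg.2 (hFbdd x hx (y k x)))
    have h2 := mul_le_mul_of_nonneg_right (mul_le_mul_of_nonneg_right (hβ k).1
      (sub_nonneg.2 hμ1.le)) (sub_nonneg.2 (hfstar_le x hx (y k x)))
    linarith
  have hbdd : ∃ C : ℝ, ∀ K, ∀ x ∈ X, ‖y K x‖ ≤ C := by
    obtain ⟨C, hC⟩ := (hlevel (B + (α 0 * μ * (A - M₀) + β 0 * (1 - μ) * (B - D))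
      / (βlow * (1 - μ)))).exists_norm_le
    refine ⟨C, fun K x hx => hC _ ⟨x, hx, ?_⟩⟩
    have h1 := (hgap K x hx).trans (energy_antitone (u := fun k => y k x) (hstep x hx) h2s haanti hbanti
      (hFbdd x hx) (hfstar_le x hx) K.zero_le)
    simp only [hy0] at h1
    have h2 : fstar x ≤ B := (hfstar_le x hx y₀).trans (hfy₀ x hx)
    have h3 : D ≤ fstar x := hqv x hx ▸ hD x hx (q x)
    have h4 := mul_le_mul_of_nonneg_left
      (show F x y₀ - M₀ ≤ A - M₀ by linarith [hFy₀ x hx]) (ha0 0)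
    have h5 := mul_le_mul_of_nonneg_left
      (show f x y₀ - fstar x ≤ B - D by linarith [hfy₀ x hx]) (hb0 0)
    have h6 : f x (y K x) - fstar x
        ≤ (α 0 * μ * (A - M₀) + β 0 * (1 - μ) * (B - D)) / (βlow * (1 - μ)) := by
      rw [le_div_iff₀ hγ]
      linarith
    linarith
  have hrate : ∀ K : ℕ, 0 < K → ∀ x ∈ X, f x (y K x) - fstar x
      ≤ ((‖y₀‖ + R) ^ 2 * (K : ℝ)⁻¹
        + 2 * s * ((A' - M₀) * μ * ((K : ℝ)⁻¹ * ∑ k ∈ Finset.range K, α k)))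
        / (2 * s * (βlow * (1 - μ))) := by
    intro K hK x hx
    have hK' : (0 : ℝ) < K := Nat.cast_pos.2 hK
    have h1 := natCast_mul_energy_le (u := fun k => y k x) (hstep x hx) h2s haanti hbanti
      (hFbdd x hx) (hfstar_le x hx) (hqv x hx) K
    simp only [hy0, ← Finset.sum_mul] at h1
    have h2 : ‖y₀ - q x‖ ^ 2 ≤ (‖y₀‖ + R) ^ 2 := by
      gcongr
      exact (norm_sub_le _ _).trans (by gcongr; exact hqR x hx)
    have h3 : (F x (q x) - M₀) * ((∑ k ∈ Finset.range K, α k) * μ)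
        ≤ (A' - M₀) * ((∑ k ∈ Finset.range K, α k) * μ) :=
      mul_le_mul_of_nonneg_right (by linarith [hFq x hx])
        (mul_nonneg (Finset.sum_nonneg fun k _ => (hα0 k).le) hμ0.le)
    have h4 := mul_le_mul_of_nonneg_left (hgap K x hx) (show 0 ≤ 2 * s * K by positivity)
    have h5 := mul_le_mul_of_nonneg_left h3 h2s.le
    rw [le_div_iff₀ (by positivity), ← mul_le_mul_iff_of_pos_left hK']
    have h6 : (K : ℝ) * ((‖y₀‖ + R) ^ 2 * (K : ℝ)⁻¹
        + 2 * s * ((A' - M₀) * μ * ((K : ℝ)⁻¹ * ∑ k ∈ Finset.range K, α k)))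
        = (‖y₀‖ + R) ^ 2 + 2 * s * ((A' - M₀) * ((∑ k ∈ Finset.range K, α k) * μ)) := by
      field_simp
    rw [h6]
    linarith
  have hαlim : Tendsto α atTop (𝓝 0) := by
    rw [funext hα]
    exact tendsto_one_div_add_atTop_nhds_zero_nat
  have hLL : ∀ ε > (0 : ℝ), ∃ N : ℕ, ∀ K ≥ N, ∀ x ∈ X, f x (y K x) - fstar x ≤ ε := by
    intro ε hε
    have hlim := ((tendsto_inv_atTop_nhds_zero_nat (𝕜 := ℝ)).const_mul ((‖y₀‖ + R) ^ 2)).add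
      ((hαlim.cesaro.const_mul ((A' - M₀) * μ)).const_mul (2 * s))
      |>.div_const (2 * s * (βlow * (1 - μ)))
    simp only [mul_zero, add_zero, zero_div] at hlim
    obtain ⟨N, hN⟩ := eventually_atTop.1
      ((hlim.eventually_le_const hε).and (eventually_gt_atTop 0))
    exact ⟨N, fun K hK x hx => (hrate K (hN K hK).2 x hx).trans (hN K hK).1⟩
  refine ⟨fun x hx => ?_, hbdd, hLL⟩
  obtain ⟨C, hC⟩ := hbdd
  have hφq : φ x = F x (q x) := by
    rw [hφ]
    exact IsLeast.csInf_eq ⟨mem_image_of_mem _ (hqS x hx), forall_mem_image.2 (hqmin x hx)⟩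
  rw [hφq]
  refine tendsto_outer_value (u := fun k => y k x) (hstep x hx) h2s ha0 hb0 ?_
    (continuous_iff_continuousAt.2 fun w => (hfgrad x w).differentiableAt.continuousAt)
    (continuous_iff_continuousAt.2 fun w => (hFgrad x w).differentiableAt.continuousAt)
    (fun k => hC k x hx) (hqf x hx) (fun w hw => hqmin x hx w ?_) ?_
  · simp_rw [← Finset.sum_mul, hα]
    exact Real.tendsto_sum_range_one_div_nat_succ_atTop.atTop_mul_const hμ0
  · rw [hS]
    exact fun w' => hw ▸ hqf x hx w'
  · rw [hqv x hx, Metric.tendsto_atTop]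
    intro ε hε
    obtain ⟨N, hN⟩ := hLL (ε / 2) (half_pos hε)
    refine ⟨N, fun K hK => ?_⟩
    rw [Real.dist_eq, abs_of_nonneg (sub_nonneg.2 (hfstar_le x hx _))]
    linarith [hN K hK x hx]
end

section
/- Let X ⊆ ℝⁿ be compact, and let F, f : ℝⁿ × ℝᵐ → ℝ be twice continuously differentiable with: for every x, F(x,·) convex, L_F-smooth and bounded below, and f(x,·) σ-strongly convex (σ > 0) and L_f-smooth; assume f is level-bounded in y uniformly in x ∈ X (for every r ∈ ℝ the set { y : ∃ x ∈ X, f(x,y) ≤ r } is bounded). Let y*(x) denote the unique minimizer of f(x,·), and define the iterates y_k(x) by y_{k+1}(x) = y_k(x) − s( α_k μ ∇_y F(x, y_k(x)) + β_k (1−μ) ∇_y f(x, y_k(x)) ), y₀(x) = y₀, with s ∈ (0, 1/max(L_F, L_f)), μ ∈ (0,1), positive nonincreasing α_k → 0, and nonincreasing β_k ∈ [β̲, 1] (β̲ > 0) with |β_k − β_{k−1}| ≤ c_β/(k+1)². Set φ_K(x) := F(x, y_K(x)) and φ(x) := F(x, y*(x)). Let x_K ∈ X satisfy ∇φ_K(x_K)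 = ε_K with ‖ε_K‖ → 0. Then every limit point x̄ of (x_K) is a stationary point of φ: ∇φ(x̄) = 0. -/
open Filter Topology Set Metric
open scoped RealInnerProductSpace

section JointLimit

/-- A nonnegative family with `u (k+1) x ≤ q * u k x + δ k x`, where `q < 1` and `δ` vanishes in the
joint limit `k → ∞`, `x → 𝓕`, vanishes in the same joint limit. -/
lemma tendsto_zero_of_contracting {E : Type*} {𝓕 : Filter E} {u δ : ℕ → E → ℝ} {q : ℝ}
    (hq0 : 0 ≤ q) (hq1 : q < 1) (hu : ∀ k x, 0 ≤ u k x)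
    (hb : ∀ k, ∃ M, ∀ᶠ x in 𝓕, u k x ≤ M)
    (hrec : ∀ᶠ k in atTop, ∀ x, u (k + 1) x ≤ q * u k x + δ k x)
    (hδ : Tendsto (fun p : ℕ × E => δ p.1 p.2) (atTop ×ˢ 𝓕) (𝓝 0)) :
    Tendsto (fun p : ℕ × E => u p.1 p.2) (atTop ×ˢ 𝓕) (𝓝 0) := by
  have hq : 0 < 1 - q := by linarith
  refine tendsto_order.2 ⟨fun a ha => .of_forall fun p => ha.trans_le (hu _ _), fun ε hε => ?_⟩
  have h1 : ∀ᶠ p : ℕ × E in atTop ×ˢ 𝓕, δ p.1 p.2 < ε / 2 * (1 - q) :=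
    hδ.eventually_lt_const (by positivity)
  obtain ⟨P, hP, Q, hQ, hPQ⟩ := eventually_prod_iff.1 h1
  obtain ⟨N, hN⟩ := eventually_atTop.1 (hP.and hrec)
  obtain ⟨M, hM⟩ := hb N
  have h2 : ∀ᶠ x in 𝓕, ∀ j, u (N + j) x ≤ q ^ j * |M| + ε / 2 := by
    filter_upwards [hM, hQ] with x hx hxQ j
    induction j with
    | zero => simpa using (hx.trans (le_abs_self M)).trans (by linarith)
    | succ j ih =>
      obtain ⟨hPj, hrecj⟩ := hN (N + j) (by omega)
      have h3 := hrecj x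
      have h4 := hPQ hPj hxQ
      have h5 := mul_le_mul_of_nonneg_left ih hq0
      rw [← add_assoc, pow_succ]
      simp only at h4
      linarith
  have h6 : Tendsto (fun j => q ^ j * |M|) atTop (𝓝 0) := by
    simpa using (tendsto_pow_atTop_nhds_zero_of_lt_one hq0 hq1).mul_const |M|
  obtain ⟨J, hJ⟩ := eventually_atTop.1 (h6.eventually_lt_const (half_pos hε))
  refine eventually_prod_iff.2
    ⟨_, eventually_ge_atTop (N + J), _, h2, fun {k} hk {x} hx => ?_⟩
  have h7 := hx (k - N)
  have h8 := hJ (k - N) (by omega)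
  rw [Nat.add_sub_cancel' (by omega)] at h7
  simp only
  linarith

end JointLimit

section PartialGradient

variable {E V : Type*} [NormedAddCommGroup E] [InnerProductSpace ℝ E]
  [NormedAddCommGroup V] [InnerProductSpace ℝ V]

/-- A symmetric operator with quadratic form between `0` and `q‖v‖²` has norm at most `q`. -/
lemma norm_apply_le_of_symmetric {A : V →L[ℝ] V} {q : ℝ} (hq : 0 ≤ q)
    (hsymm : ∀ v w, ⟪A v, w⟫ = ⟪v, A w⟫) (hpos : ∀ v, 0 ≤ ⟪A v, v⟫)
    (hle : ∀ v, ⟪A v, v⟫ ≤ q * ‖v‖ ^ 2) (v : V) : ‖A v‖ ≤ q * ‖v‖ := by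
  have key : ∀ t : ℝ, 0 ≤ ⟪A (A v), A v⟫ * (t * t) + 2 * ⟪A v, A v⟫ * t + ⟪A v, v⟫ := fun t => by
    have h := hpos (v + t • A v)
    simp only [map_add, map_smul, inner_add_left, inner_add_right, real_inner_smul_left,
      real_inner_smul_right] at h
    rw [hsymm (A v) v] at h
    linarith
  have h := discrim_le_zero key
  rw [discrim, real_inner_self_eq_norm_sq] at h
  have h1 : ⟪A (A v), A v⟫ * ⟪A v, v⟫ ≤ (q * ‖A v‖ ^ 2) * (q * ‖v‖ ^ 2) :=
    mul_le_mul (hle _) (hle v) (hpos v) (by positivity)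
  rcases (norm_nonneg (A v)).eq_or_lt with h0 | h0
  · rw [← h0]; positivity
  · have h2 : ‖A v‖ ^ 2 * ‖A v‖ ^ 2 ≤ ‖A v‖ ^ 2 * (q * ‖v‖) ^ 2 := by nlinarith
    exact le_of_sq_le_sq (le_of_mul_le_mul_left h2 (by positivity)) (by positivity)

variable [CompleteSpace V]

/-- The gradient of `F` in its second variable, as a function on the product space. -/
noncomputable def partialGrad (F : E → V → ℝ) (p : E × V) : V := gradient (F p.1) p.2

variable {F : E → V → ℝ}

omit [CompleteSpace V] in
lemma hasFDerivAt_snd_variable (hF : ContDiff ℝ 2 fun p : E × V => F p.1 p.2) (p : E × V) :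
    HasFDerivAt (F p.1)
      ((fderiv ℝ (fun p : E × V => F p.1 p.2) p).comp (ContinuousLinearMap.inr ℝ E V)) p.2 := by
  have h := (hF.differentiable (by norm_num) p).hasFDerivAt
  exact HasFDerivAt.comp p.2 (f := fun w => (p.1, w)) h (hasFDerivAt_prodMk_right p.1 p.2)

lemma inner_partialGrad (hF : ContDiff ℝ 2 fun p : E × V => F p.1 p.2) (p : E × V) (w : V) :
    ⟪partialGrad F p, w⟫ = fderiv ℝ (fun p : E × V => F p.1 p.2) p (0, w) := by
  rw [partialGrad, gradient, InnerProductSpace.toDual_symm_apply,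
    (hasFDerivAt_snd_variable hF p).fderiv]
  rfl

lemma contDiff_partialGrad (hF : ContDiff ℝ 2 fun p : E × V => F p.1 p.2) :
    ContDiff ℝ 1 (partialGrad F) := by
  have h : partialGrad F = fun p => (InnerProductSpace.toDual ℝ V).symm
      ((fderiv ℝ (fun p : E × V => F p.1 p.2) p).comp (ContinuousLinearMap.inr ℝ E V)) := by
    ext1 p
    rw [partialGrad, gradient, (hasFDerivAt_snd_variable hF p).fderiv]
  rw [h]
  exact (InnerProductSpace.toDual ℝ V).symm.contDiff.comp
    ((hF.fderiv_right (by norm_num)).clm_comp contDiff_const)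

lemma inner_fderiv_partialGrad (hF : ContDiff ℝ 2 fun p : E × V => F p.1 p.2) (p u : E × V)
    (w : V) :
    ⟪fderiv ℝ (partialGrad F) p u, w⟫ =
      fderiv ℝ (fderiv ℝ fun p : E × V => F p.1 p.2) p u (0, w) := by
  have h1 : HasFDerivAt (fun p => ⟪partialGrad F p, w⟫) _ p :=
    (((contDiff_partialGrad hF).differentiable (by norm_num) p).hasFDerivAt).inner ℝ
      (hasFDerivAt_const w p)
  have h2 : HasFDerivAt (fun p => fderiv ℝ (fun p : E × V => F p.1 p.2) p (0, w)) _ p :=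
    (((hF.fderiv_right (m := 1) (by norm_num)).differentiable (by norm_num) p).hasFDerivAt).clm_apply
      (hasFDerivAt_const (0, w) p)
  simp only [inner_partialGrad hF] at h1
  have h := DFunLike.congr_fun (h1.unique h2) u
  simpa using h

lemma inner_fderiv_partialGrad_comm (hF : ContDiff ℝ 2 fun p : E × V => F p.1 p.2) (p : E × V)
    (v w : V) :
    ⟪fderiv ℝ (partialGrad F) p (0, v), w⟫ = ⟪v, fderiv ℝ (partialGrad F) p (0, w)⟫ := by
  rw [real_inner_comm _ v, inner_fderiv_partialGrad hF, inner_fderiv_partialGrad hF]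
  exact hF.contDiffAt.isSymmSndFDerivAt (by simp) _ _

/-- Strong convexity in the second variable bounds the partial Hessian from below. -/
lemma le_inner_fderiv_partialGrad (hF : ContDiff ℝ 2 fun p : E × V => F p.1 p.2) {σ : ℝ}
    (hconv : ∀ x, ConvexOn ℝ univ fun w => F x w - σ / 2 * ‖w‖ ^ 2) (p : E × V) (v : V) :
    σ * ‖v‖ ^ 2 ≤ ⟪fderiv ℝ (partialGrad F) p (0, v), v⟫ := by
  obtain ⟨x, w⟩ := p
  have hline : ∀ t : ℝ, HasDerivAt (fun t : ℝ => w + t • v) v t := fun t => by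
    simpa using ((hasDerivAt_id t).smul_const v).const_add w
  have hd : ∀ t : ℝ, HasDerivAt (fun t : ℝ => F x (w + t • v) - σ / 2 * ‖w + t • v‖ ^ 2)
      (⟪partialGrad F (x, w + t • v), v⟫ - σ * ⟪w + t • v, v⟫) t := fun t => by
    have h1 := (hasFDerivAt_snd_variable hF (x, w + t • v)).comp_hasDerivAt t (hline t)
    have h2 := ((hline t).norm_sq).const_mul (σ / 2)
    rw [inner_partialGrad hF]
    exact (h1.sub h2).congr_deriv (by simp; ring)
  have hmono : Monotone fun t : ℝ =>
      ⟪partialGrad F (x, w + t • v), v⟫ - σ * ⟪w + t • v, v⟫ := by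
    have hc : ConvexOn ℝ univ fun t : ℝ => F x (w + t • v) - σ / 2 * ‖w + t • v‖ ^ 2 := by
      have h := (hconv x).comp_affineMap (AffineMap.lineMap w (w + v) : ℝ →ᵃ[ℝ] V)
      have he : ((fun w => F x w - σ / 2 * ‖w‖ ^ 2) ∘ (AffineMap.lineMap w (w + v) : ℝ →ᵃ[ℝ] V))
          = fun t : ℝ => F x (w + t • v) - σ / 2 * ‖w + t • v‖ ^ 2 := by
        ext t
        simp [AffineMap.lineMap_apply, add_comm]
      rwa [he, preimage_univ] at h
    have h := hc.monotoneOn_deriv fun t _ => (hd t).differentiableAt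
    rw [monotoneOn_univ, funext fun t => (hd t).deriv] at h
    exact h
  have hpath : HasDerivAt (fun t : ℝ => (x, w + t • v)) (0, v) 0 :=
    (hasDerivAt_const 0 x).prodMk (hline 0)
  have h0 : (x, w + (0 : ℝ) • v) = (x, w) := by simp
  have hg : HasDerivAt (fun t : ℝ => partialGrad F (x, w + t • v))
      (fderiv ℝ (partialGrad F) (x, w) (0, v)) 0 := by
    have h := ((contDiff_partialGrad hF).differentiable (by norm_num)
      (x, w + (0 : ℝ) • v)).hasFDerivAt.comp_hasDerivAt (0 : ℝ) hpath
    rwa [h0] at h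
  have h3 : HasDerivAt (fun t : ℝ => ⟪partialGrad F (x, w + t • v), v⟫ - σ * ⟪w + t • v, v⟫)
      (⟪fderiv ℝ (partialGrad F) (x, w) (0, v), v⟫ - σ * ‖v‖ ^ 2) 0 := by
    have h := (hg.inner ℝ (hasDerivAt_const (0 : ℝ) v)).sub
      (((hline 0).inner ℝ (hasDerivAt_const (0 : ℝ) v)).const_mul σ)
    exact h.congr_deriv (by simp)
  have h4 := hmono.deriv_nonneg (x := 0)
  rw [h3.deriv] at h4
  linarith

/-- A Lipschitz partial gradient bounds the partial Hessian from above. -/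
lemma inner_fderiv_partialGrad_le (hF : ContDiff ℝ 2 fun p : E × V => F p.1 p.2) {M : ℝ}
    (hM : 0 ≤ M) (hlip : ∀ x a b, ‖gradient (F x) a - gradient (F x) b‖ ≤ M * ‖a - b‖)
    (p : E × V) (v : V) :
    ⟪fderiv ℝ (partialGrad F) p (0, v), v⟫ ≤ M * ‖v‖ ^ 2 := by
  have h := ((contDiff_partialGrad hF).differentiable (by norm_num) p).hasFDerivAt
  have h1 := HasFDerivAt.comp p.2 (f := fun w => (p.1, w)) h (hasFDerivAt_prodMk_right p.1 p.2)
  have h2 := h1.le_of_lip' hM (.of_forall fun w => hlip p.1 w p.2)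
  have h3 := ContinuousLinearMap.le_of_opNorm_le _ h2 v
  calc ⟪fderiv ℝ (partialGrad F) p (0, v), v⟫
      ≤ ‖fderiv ℝ (partialGrad F) p (0, v)‖ * ‖v‖ := real_inner_le_norm _ _
    _ ≤ M * ‖v‖ * ‖v‖ := by gcongr; exact h3
    _ = M * ‖v‖ ^ 2 := by ring

end PartialGradient

section Iteration

variable {E V : Type*} [NormedAddCommGroup E] [NormedSpace ℝ E]
  [NormedAddCommGroup V] [NormedSpace ℝ V] {G : ℕ → E × V → V} {y : ℕ → E → V}

lemma contDiff_iterate (hG : ∀ k, ContDiff ℝ 1 (G k)) (hy0 : ContDiff ℝ 1 (y 0))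
    (hy : ∀ k x, y (k + 1) x = y k x - G k (x, y k x)) (k : ℕ) : ContDiff ℝ 1 (y k) := by
  induction k with
  | zero => exact hy0
  | succ k ih =>
    rw [funext (hy k)]
    exact ih.sub ((hG k).comp (contDiff_id.prodMk ih))

lemma norm_step_sub_step_le {g : E × V → V} {q : ℝ} (hg : ContDiff ℝ 1 g)
    (hq : 0 ≤ q) (hc : ∀ p v, ‖v - fderiv ℝ g p (0, v)‖ ≤ q * ‖v‖) (x : E) (v w : V) :
    ‖(v - g (x, v)) - (w - g (x, w))‖ ≤ q * ‖v - w‖ := by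
  have hd : ∀ u : V, HasFDerivAt (fun u => u - g (x, u))
      (ContinuousLinearMap.id ℝ V - (fderiv ℝ g (x, u)).comp (ContinuousLinearMap.inr ℝ E V)) u :=
    fun u => (hasFDerivAt_id u).sub
      ((hg.differentiable (by norm_num) (x, u)).hasFDerivAt.comp u (hasFDerivAt_prodMk_right x u))
  refine convex_univ.norm_image_sub_le_of_norm_fderiv_le (𝕜 := ℝ) (f := fun u => u - g (x, u))
    (fun u _ => (hd u).differentiableAt) (fun u _ => ?_) (mem_univ w) (mem_univ v)
  rw [(hd u).fderiv]
  exact ContinuousLinearMap.opNorm_le_bound _ hq fun v => by simpa using hc (x, u) v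

/-- Iterates of eventually uniformly contracting steps converge jointly in `(k, x)` to any point at
which the steps asymptotically vanish. -/
lemma tendsto_iterate {q : ℝ} {xb : E} {yb : V} (hG : ∀ k, ContDiff ℝ 1 (G k))
    (hycont : ∀ k, Continuous (y k))
    (hy : ∀ k x, y (k + 1) x = y k x - G k (x, y k x)) (hq0 : 0 ≤ q) (hq1 : q < 1)
    (hc : ∀ᶠ k in atTop, ∀ p v, ‖v - fderiv ℝ (G k) p (0, v)‖ ≤ q * ‖v‖)
    (h0 : Tendsto (fun p : ℕ × E => G p.1 (p.2, yb)) (atTop ×ˢ 𝓝 xb) (𝓝 0)) :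
    Tendsto (fun p : ℕ × E => y p.1 p.2) (atTop ×ˢ 𝓝 xb) (𝓝 yb) := by
  rw [tendsto_iff_norm_sub_tendsto_zero]
  refine tendsto_zero_of_contracting (u := fun k x => ‖y k x - yb‖)
    (δ := fun k x => ‖G k (x, yb)‖) hq0 hq1 (fun _ _ => norm_nonneg _) (fun k => ?_) ?_
    (by simpa using h0.norm)
  · have h : Continuous fun x => ‖y k x - yb‖ := ((hycont k).sub continuous_const).norm
    exact ⟨_, (h.tendsto xb).eventually_le_const (lt_add_one _)⟩
  · filter_upwards [hc] with k hk x
    have h1 := norm_step_sub_step_le (hG k) hq0 hk x (y k x) yb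
    calc ‖y (k + 1) x - yb‖
        = ‖((y k x - G k (x, y k x)) - (yb - G k (x, yb))) - G k (x, yb)‖ := by
          rw [hy]; congr 1; abel
      _ ≤ q * ‖y k x - yb‖ + ‖G k (x, yb)‖ := (norm_sub_le _ _).trans (by gcongr)

/-- Derivatives of the iterates converge jointly in `(k, x)` to any `D` solving the linearised
equation asymptotically. -/
lemma tendsto_fderiv_iterate {q : ℝ} {xb : E} {yb : V} {D : E →L[ℝ] V}
    (hG : ∀ k, ContDiff ℝ 1 (G k)) (hyC : ∀ k, ContDiff ℝ 1 (y k))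
    (hy : ∀ k x, y (k + 1) x = y k x - G k (x, y k x)) (hq0 : 0 ≤ q) (hq1 : q < 1)
    (hc : ∀ᶠ k in atTop, ∀ p v, ‖v - fderiv ℝ (G k) p (0, v)‖ ≤ q * ‖v‖)
    (hlim : Tendsto (fun p : ℕ × E => y p.1 p.2) (atTop ×ˢ 𝓝 xb) (𝓝 yb))
    (h0 : Tendsto (fun p : ℕ × (E × V) =>
      (fderiv ℝ (G p.1) p.2).comp ((ContinuousLinearMap.id ℝ E).prod D))
      (atTop ×ˢ 𝓝 (xb, yb)) (𝓝 0)) :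
    Tendsto (fun p : ℕ × E => fderiv ℝ (y p.1) p.2) (atTop ×ˢ 𝓝 xb) (𝓝 D) := by
  rw [tendsto_iff_norm_sub_tendsto_zero]
  refine tendsto_zero_of_contracting (u := fun k x => ‖fderiv ℝ (y k) x - D‖)
    (δ := fun k x => ‖(fderiv ℝ (G k) (x, y k x)).comp ((ContinuousLinearMap.id ℝ E).prod D)‖)
    hq0 hq1 (fun _ _ => norm_nonneg _) (fun k => ?_) ?_ ?_
  · have h : Continuous fun x => ‖fderiv ℝ (y k) x - D‖ :=
      (((hyC k).continuous_fderiv (by norm_num)).sub continuous_const).norm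
    exact ⟨_, (h.tendsto xb).eventually_le_const (lt_add_one _)⟩
  · filter_upwards [hc] with k hk x
    have hyd := ((hyC k).differentiable (by norm_num) x).hasFDerivAt
    have hd : HasFDerivAt (y (k + 1)) (fderiv ℝ (y k) x - (fderiv ℝ (G k) (x, y k x)).comp
        ((ContinuousLinearMap.id ℝ E).prod (fderiv ℝ (y k) x))) x := by
      rw [funext (hy k)]
      exact hyd.sub (((hG k).differentiable (by norm_num) (x, y k x)).hasFDerivAt.comp x
        ((hasFDerivAt_id x).prodMk hyd))
    set A := ContinuousLinearMap.id ℝ V -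
      (fderiv ℝ (G k) (x, y k x)).comp (ContinuousLinearMap.inr ℝ E V)
    have hA : ‖A‖ ≤ q := ContinuousLinearMap.opNorm_le_bound _ hq0 fun v => by
      simpa [A] using hk (x, y k x) v
    have he : fderiv ℝ (y (k + 1)) x - D = A.comp (fderiv ℝ (y k) x - D) -
        (fderiv ℝ (G k) (x, y k x)).comp ((ContinuousLinearMap.id ℝ E).prod D) := by
      rw [hd.fderiv]
      ext u
      have h1 : ∀ v : V, ((u, v) : E × V) = (u, 0) + (0, v) := fun v => by simp
      have h2 : ∀ v w : V, ((0, v - w) : E × V) = (0, v) - (0, w) := fun v w => by simp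
      simp only [A, _root_.sub_apply, ContinuousLinearMap.comp_apply,
        ContinuousLinearMap.prod_apply, ContinuousLinearMap.id_apply,
        ContinuousLinearMap.inr_apply]
      rw [h1 (fderiv ℝ (y k) x u), h1 (D u), h2]
      simp only [map_add, map_sub]
      abel
    rw [he]
    refine (norm_sub_le _ _).trans ?_
    gcongr
    exact (ContinuousLinearMap.opNorm_comp_le _ _).trans (by gcongr)
  · have h : Tendsto (fun p : ℕ × E => (p.1, (p.2, y p.1 p.2))) (atTop ×ˢ 𝓝 xb)
        (atTop ×ˢ 𝓝 (xb, yb)) :=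
      tendsto_fst.prodMk (tendsto_snd.prodMk_nhds hlim)
    simpa using (h0.comp h).norm

end Iteration

section GradientStep

variable {E V : Type*} [NormedAddCommGroup E] [InnerProductSpace ℝ E]
  [NormedAddCommGroup V] [InnerProductSpace ℝ V] [CompleteSpace V] {F f : E → V → ℝ}

lemma norm_sub_fderiv_combination_le
    (hF : ContDiff ℝ 2 fun p : E × V => F p.1 p.2) (hf : ContDiff ℝ 2 fun p : E × V => f p.1 p.2)
    {M σ a b q : ℝ} (hM : 0 ≤ M)
    (hFconv : ∀ x, ConvexOn ℝ univ (F x))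
    (hFlip : ∀ x a b, ‖gradient (F x) a - gradient (F x) b‖ ≤ M * ‖a - b‖)
    (hfstrong : ∀ x, ConvexOn ℝ univ fun w => f x w - σ / 2 * ‖w‖ ^ 2)
    (hflip : ∀ x a b, ‖gradient (f x) a - gradient (f x) b‖ ≤ M * ‖a - b‖)
    (ha : 0 ≤ a) (hb : 0 ≤ b) (hab : (a + b) * M ≤ 1) (hq : 0 ≤ q) (hbq : 1 - b * σ ≤ q)
    (p : E × V) (v : V) :
    ‖v - fderiv ℝ (fun p => a • partialGrad F p + b • partialGrad f p) p (0, v)‖ ≤ q * ‖v‖ := by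
  have hFd := (contDiff_partialGrad hF).differentiable (by norm_num) p
  have hfd := (contDiff_partialGrad hf).differentiable (by norm_num) p
  have hd : fderiv ℝ (fun p => a • partialGrad F p + b • partialGrad f p) p =
      a • fderiv ℝ (partialGrad F) p + b • fderiv ℝ (partialGrad f) p :=
    ((hFd.hasFDerivAt.const_smul a).add (hfd.hasFDerivAt.const_smul b)).fderiv
  rw [hd]
  have hq' : ∀ w : V, ⟪w - (a • fderiv ℝ (partialGrad F) p (0, w) +
      b • fderiv ℝ (partialGrad f) p (0, w)), w⟫ = ‖w‖ ^ 2 -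
      (a * ⟪fderiv ℝ (partialGrad F) p (0, w), w⟫ + b * ⟪fderiv ℝ (partialGrad f) p (0, w), w⟫) :=
    fun w => by
      rw [inner_sub_left, inner_add_left, real_inner_smul_left, real_inner_smul_left,
        real_inner_self_eq_norm_sq]
  refine norm_apply_le_of_symmetric (A := ContinuousLinearMap.id ℝ V -
    (a • fderiv ℝ (partialGrad F) p + b • fderiv ℝ (partialGrad f) p).comp
      (ContinuousLinearMap.inr ℝ E V)) hq (fun v w => ?_) (fun w => ?_) (fun w => ?_) v
  · simp only [_root_.sub_apply, ContinuousLinearMap.id_apply,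
      ContinuousLinearMap.comp_apply, ContinuousLinearMap.inr_apply,
      _root_.add_apply, _root_.smul_apply, inner_sub_left,
      inner_sub_right, inner_add_left, inner_add_right, real_inner_smul_left,
      real_inner_smul_right, inner_fderiv_partialGrad_comm hF, inner_fderiv_partialGrad_comm hf]
  · refine le_of_le_of_eq ?_ (hq' w).symm
    have h1 := mul_le_mul_of_nonneg_left (inner_fderiv_partialGrad_le hF hM hFlip p w) ha
    have h2 := mul_le_mul_of_nonneg_left (inner_fderiv_partialGrad_le hf hM hflip p w) hb
    have h3 := mul_le_mul_of_nonneg_right hab (sq_nonneg ‖w‖)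
    linarith
  · refine (hq' w).trans_le ?_
    have h1 := le_inner_fderiv_partialGrad hF (σ := 0) (by simpa using hFconv) p w
    rw [zero_mul] at h1
    have h1' := mul_nonneg ha h1
    have h2 := mul_le_mul_of_nonneg_left (le_inner_fderiv_partialGrad hf hfstrong p w) hb
    have h3 := mul_le_mul_of_nonneg_right hbq (sq_nonneg ‖w‖)
    linarith

/-- The linear equation for the derivative of the minimiser is solvable under strong convexity. -/
lemma exists_linearised_solution [FiniteDimensional ℝ V]
    (hf : ContDiff ℝ 2 fun p : E × V => f p.1 p.2) {σ : ℝ} (hσ : 0 < σ)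
    (hfstrong : ∀ x, ConvexOn ℝ univ fun w => f x w - σ / 2 * ‖w‖ ^ 2) (p : E × V) :
    ∃ D : E →L[ℝ] V,
      (fderiv ℝ (partialGrad f) p).comp ((ContinuousLinearMap.id ℝ E).prod D) = 0 := by
  set C := fderiv ℝ (partialGrad f) p with hC
  have hinj : Function.Injective (C.comp (ContinuousLinearMap.inr ℝ E V) : V →ₗ[ℝ] V) := by
    refine (injective_iff_map_eq_zero _).2 fun v hv => ?_
    have h := le_inner_fderiv_partialGrad hf hfstrong p v
    have hv' : C (0, v) = 0 := hv
    rw [← hC, hv', inner_zero_left] at h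
    have h2 : ‖v‖ ^ 2 ≤ 0 := by nlinarith
    exact norm_eq_zero.1 (pow_eq_zero_iff two_ne_zero |>.1 (le_antisymm h2 (sq_nonneg _)))
  obtain ⟨R, hR⟩ := LinearMap.exists_rightInverse_of_surjective _
    (LinearMap.range_eq_top.2 (LinearMap.injective_iff_surjective.1 hinj))
  refine ⟨-(LinearMap.toContinuousLinearMap R).comp (C.comp (ContinuousLinearMap.inl ℝ E V)), ?_⟩
  ext u
  have h1 : ∀ v : V, C (u, v) = C (u, 0) + C (0, v) := fun v => by rw [← map_add]; simp
  have h2 : C (0, R (C (u, 0))) = C (u, 0) := LinearMap.congr_fun hR (C (u, 0))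
  have h3 : ((0, -R (C (u, 0))) : E × V) = -(0, R (C (u, 0))) := by simp
  change C (u, -R (C (u, 0))) = 0
  rw [h1, h3, map_neg, h2, add_neg_cancel]

variable [FiniteDimensional ℝ V]

/-- The value function `x ↦ F x (ystar x)` is differentiable, and the derivatives of
`x ↦ F x (y k x)` along the gradient iterates converge to its derivative jointly in `(k, x)`. -/
theorem exists_hasFDerivAt_tendsto_fderiv
    (hF : ContDiff ℝ 2 fun p : E × V => F p.1 p.2) (hf : ContDiff ℝ 2 fun p : E × V => f p.1 p.2)
    {M σ q b₀ : ℝ} (hM : 0 ≤ M) (hσ : 0 < σ)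
    (hFconv : ∀ x, ConvexOn ℝ univ (F x))
    (hFlip : ∀ x a b, ‖gradient (F x) a - gradient (F x) b‖ ≤ M * ‖a - b‖)
    (hfstrong : ∀ x, ConvexOn ℝ univ fun w => f x w - σ / 2 * ‖w‖ ^ 2)
    (hflip : ∀ x a b, ‖gradient (f x) a - gradient (f x) b‖ ≤ M * ‖a - b‖)
    {ystar : E → V} (hystar : ∀ x w, f x (ystar x) ≤ f x w)
    {a b : ℕ → ℝ} (ha : ∀ k, 0 ≤ a k) (hb : ∀ k, 0 ≤ b k)
    (hab : ∀ᶠ k in atTop, (a k + b k) * M ≤ 1) (hq0 : 0 ≤ q) (hq1 : q < 1)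
    (hbq : ∀ k, 1 - b k * σ ≤ q)
    (ha0 : Tendsto a atTop (𝓝 0)) (hb0 : Tendsto b atTop (𝓝 b₀))
    {y : ℕ → E → V} (hy0 : ContDiff ℝ 1 (y 0))
    (hy : ∀ k x, y (k + 1) x =
      y k x - (a k • gradient (F x) (y k x) + b k • gradient (f x) (y k x))) (xb : E) :
    ∃ L : E →L[ℝ] ℝ, HasFDerivAt (fun x => F x (ystar x)) L xb ∧
      Tendsto (fun p : ℕ × E => fderiv ℝ (fun x => F x (y p.1 x)) p.2)
        (atTop ×ˢ 𝓝 xb) (𝓝 L) := by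
  set G : ℕ → E × V → V := fun k p => a k • partialGrad F p + b k • partialGrad f p
  have hgF := contDiff_partialGrad hF
  have hgf := contDiff_partialGrad hf
  have hG : ∀ k, ContDiff ℝ 1 (G k) := fun k =>
    (contDiff_const.smul hgF).add (contDiff_const.smul hgf)
  have hyC := contDiff_iterate hG hy0 hy
  have hc : ∀ᶠ k in atTop, ∀ p v, ‖v - fderiv ℝ (G k) p (0, v)‖ ≤ q * ‖v‖ := by
    filter_upwards [hab] with k hk
    exact norm_sub_fderiv_combination_le hF hf hM hFconv hFlip hfstrong hflip (ha k) (hb k) hk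
      hq0 (hbq k)
  have hgrad : ∀ x, partialGrad f (x, ystar x) = 0 := fun x => by
    have h : IsLocalMin (f x) (ystar x) := .of_forall (hystar x)
    rw [partialGrad, gradient, h.fderiv_eq_zero, map_zero]
  have hlim : ∀ x, Tendsto (fun p : ℕ × E => y p.1 p.2) (atTop ×ˢ 𝓝 x) (𝓝 (ystar x)) := fun x => by
    refine tendsto_iterate hG (fun k => (hyC k).continuous) hy hq0 hq1 hc ?_
    have hx : Tendsto (fun p : ℕ × E => (p.2, ystar x)) (atTop ×ˢ 𝓝 x) (𝓝 (x, ystar x)) :=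
      tendsto_snd.prodMk_nhds tendsto_const_nhds
    have h := ((ha0.comp tendsto_fst).smul ((hgF.continuous.tendsto _).comp hx)).add
      ((hb0.comp tendsto_fst).smul ((hgf.continuous.tendsto _).comp hx))
    simpa [hgrad] using h
  obtain ⟨D, hD⟩ := exists_linearised_solution hf hσ hfstrong (xb, ystar xb)
  have hlimD : Tendsto (fun p : ℕ × E => fderiv ℝ (y p.1) p.2) (atTop ×ˢ 𝓝 xb) (𝓝 D) := by
    refine tendsto_fderiv_iterate hG hyC hy hq0 hq1 hc (hlim xb) ?_
    set S : E →L[ℝ] E × V := (ContinuousLinearMap.id ℝ E).prod D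
    have hcomp : ∀ g : E × V → V, ContDiff ℝ 1 g →
        Tendsto (fun p : ℕ × (E × V) => (fderiv ℝ g p.2).comp S) (atTop ×ˢ 𝓝 (xb, ystar xb))
          (𝓝 ((fderiv ℝ g (xb, ystar xb)).comp S)) := fun g hg =>
      (((hg.continuous_fderiv (by norm_num)).clm_comp continuous_const).tendsto _).comp tendsto_snd
    have h := ((ha0.comp tendsto_fst).smul (hcomp _ hgF)).add
      ((hb0.comp tendsto_fst).smul (hcomp _ hgf))
    rw [hD, zero_smul, smul_zero, add_zero] at h
    refine h.congr fun p => ?_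
    have hd : fderiv ℝ (G p.1) p.2 =
        a p.1 • fderiv ℝ (partialGrad F) p.2 + b p.1 • fderiv ℝ (partialGrad f) p.2 :=
      (((hgF.differentiable (by norm_num) p.2).hasFDerivAt.const_smul _).add
        ((hgf.differentiable (by norm_num) p.2).hasFDerivAt.const_smul _)).fderiv
    rw [hd]
    rfl
  have hφ : ∀ k x, HasFDerivAt (fun x => F x (y k x))
      ((fderiv ℝ (fun p : E × V => F p.1 p.2) (x, y k x)).comp
        ((ContinuousLinearMap.id ℝ E).prod (fderiv ℝ (y k) x))) x := fun k x =>
    HasFDerivAt.comp x (f := fun x => (x, y k x))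
      ((hF.differentiable (by norm_num) (x, y k x)).hasFDerivAt)
      ((hasFDerivAt_id x).prodMk ((hyC k).differentiable (by norm_num) x).hasFDerivAt)
  have hφlim : Tendsto (fun p : ℕ × E => fderiv ℝ (fun x => F x (y p.1 x)) p.2) (atTop ×ˢ 𝓝 xb)
      (𝓝 ((fderiv ℝ (fun p : E × V => F p.1 p.2) (xb, ystar xb)).comp
        ((ContinuousLinearMap.id ℝ E).prod D))) := by
    simp only [(hφ _ _).fderiv]
    have h1 := ((hF.continuous_fderiv (by norm_num)).tendsto (xb, ystar xb)).comp
      (tendsto_snd.prodMk_nhds (hlim xb))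
    have h2 : Continuous fun D : E →L[ℝ] V => (ContinuousLinearMap.id ℝ E).prod D :=
      (ContinuousLinearMap.prodₗᵢ ℝ (𝕜 := ℝ) (E := E) (F := E) (G := V)).continuous.comp
        (continuous_const.prodMk continuous_id)
    exact ((continuous_fst.clm_comp continuous_snd).tendsto _).comp
      (h1.prodMk_nhds ((h2.tendsto D).comp hlimD))
  refine ⟨_, ?_, hφlim⟩
  refine hasFDerivAt_of_tendstoUniformlyOnFilter (l := atTop) (f := fun k x => F x (y k x))
    (f' := fun k x => fderiv ℝ (fun x => F x (y k x)) x) (g' := fun _ => _)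
    (tendsto_prod_filter_iff.1 hφlim)
    (.of_forall fun p => (hφ p.1 p.2).differentiableAt.hasFDerivAt) (.of_forall fun x => ?_)
  have hk : Tendsto (fun k : ℕ => (k, x)) atTop (atTop ×ˢ 𝓝 x) :=
    tendsto_id.prodMk tendsto_const_nhds
  exact (hF.continuous.tendsto (x, ystar x)).comp
    (tendsto_const_nhds.prodMk_nhds ((hlim x).comp hk))

end GradientStep

theorem stmt12 {n m : ℕ}
    (X : Set (EuclideanSpace ℝ (Fin n))) (hX : IsCompact X)
    (F f : EuclideanSpace ℝ (Fin n) → EuclideanSpace ℝ (Fin m) → ℝ)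
    (hF2 : ContDiff ℝ 2 (fun p : EuclideanSpace ℝ (Fin n) × EuclideanSpace ℝ (Fin m) => F p.1 p.2))
    (hf2 : ContDiff ℝ 2 (fun p : EuclideanSpace ℝ (Fin n) × EuclideanSpace ℝ (Fin m) => f p.1 p.2))
    (LF Lf σ : ℝ) (hσ : 0 < σ)
    (hFconv : ∀ x, ConvexOn ℝ univ (F x))
    (hFlip : ∀ x a b, ‖gradient (F x) a - gradient (F x) b‖ ≤ LF * ‖a - b‖)
    (hFbdd : ∀ x, BddBelow (Set.range (F x)))
    (hfstrong : ∀ x, ConvexOn ℝ univ (fun w => f x w - σ / 2 * ‖w‖ ^ 2))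
    (hflip : ∀ x a b, ‖gradient (f x) a - gradient (f x) b‖ ≤ Lf * ‖a - b‖)
    -- f is level-bounded in y uniformly in x ∈ X
    (hlevel : ∀ r : ℝ, Bornology.IsBounded {w : EuclideanSpace ℝ (Fin m) | ∃ x ∈ X, f x w ≤ r})
    -- y*(x) : the unique minimizer of f(x,·)
    (ystar : EuclideanSpace ℝ (Fin n) → EuclideanSpace ℝ (Fin m))
    (hystar : ∀ x w, f x (ystar x) ≤ f x w)
    (hystaruniq : ∀ x w, (∀ w', f x w ≤ f x w') → w = ystar x)
    (s μ : ℝ) (hs : s ∈ Ioo 0 (1 / max LF Lf)) (hμ : μ ∈ Ioo (0 : ℝ) 1)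
    (α : ℕ → ℝ) (hαpos : ∀ k, 0 < α k) (hαanti : Antitone α) (hαto : Tendsto α atTop (𝓝 0))
    (βlow cβ : ℝ) (hβlow : 0 < βlow) (hcβ : 0 < cβ)
    (β : ℕ → ℝ) (hβ : ∀ k, β k ∈ Icc βlow 1) (hβanti : Antitone β)
    (hβdiff : ∀ k ≥ 1, |β k - β (k - 1)| ≤ cβ / ((k : ℝ) + 1) ^ 2)
    (y₀ : EuclideanSpace ℝ (Fin m))
    (y : ℕ → EuclideanSpace ℝ (Fin n) → EuclideanSpace ℝ (Fin m))
    (hy0 : ∀ x, y 0 x = y₀)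
    (hyrec : ∀ k x, y (k + 1) x =
      y k x - ((α k * μ * s) • gradient (F x) (y k x)
             + (β k * (1 - μ) * s) • gradient (f x) (y k x)))
    -- ε_K-stationary points of φ_K
    (xK : ℕ → EuclideanSpace ℝ (Fin n)) (hxKX : ∀ K, xK K ∈ X)
    (εv : ℕ → EuclideanSpace ℝ (Fin n))
    (hstat : ∀ K, gradient (fun x => F x (y K x)) (xK K) = εv K)
    (hεto : Tendsto (fun K => ‖εv K‖) atTop (𝓝 0)) :
    ∀ xb : EuclideanSpace ℝ (Fin n),
      (∃ ι : ℕ → ℕ, StrictMono ι ∧ Tendsto (fun K => xK (ι K)) atTop (𝓝 xb)) →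
      gradient (fun x => F x (ystar x)) xb = 0 := by
  rintro xb ⟨ι, hι, hxb⟩
  have hs0 : 0 < s := hs.1
  have hμ0 : 0 < μ := hμ.1
  have hμ1 : 0 < 1 - μ := sub_pos.2 hμ.2
  have hM : 0 < max LF Lf := one_div_pos.1 (hs.1.trans hs.2)
  have hsM : s * max LF Lf < 1 := (lt_div_iff₀ hM).1 hs.2
  have hβ0 : Tendsto β atTop (𝓝 (⨅ k, β k)) :=
    tendsto_atTop_ciInf hβanti ⟨βlow, by rintro _ ⟨k, rfl⟩; exact (hβ k).1⟩
  have hq1 : max 0 (1 - βlow * (1 - μ) * s * σ) < 1 := by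
    have h : 0 < βlow * (1 - μ) * s * σ := by positivity
    exact max_lt one_pos (by linarith)
  obtain ⟨L, hL, hlim⟩ := exists_hasFDerivAt_tendsto_fderiv hF2 hf2 (M := max LF Lf) (σ := σ)
    (q := max 0 (1 - βlow * (1 - μ) * s * σ)) hM.le hσ hFconv
    (fun x a b => (hFlip x a b).trans (by gcongr; exact le_max_left _ _)) hfstrong
    (fun x a b => (hflip x a b).trans (by gcongr; exact le_max_right _ _)) hystar
    (a := fun k => α k * μ * s) (b := fun k => β k * (1 - μ) * s)
    (fun k => by have := hαpos k; positivity)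
    (fun k => by have := hβlow.trans_le (hβ k).1; positivity)
    (by
      filter_upwards [hαto.eventually_le_const one_pos] with k hk
      have h1 : α k * μ * s ≤ 1 * μ * s := by gcongr
      have h2 : β k * (1 - μ) * s ≤ 1 * (1 - μ) * s := by gcongr; exact (hβ k).2
      have h3 : α k * μ * s + β k * (1 - μ) * s ≤ s := by linarith
      exact (mul_le_mul_of_nonneg_right h3 hM.le).trans hsM.le)
    (le_max_left _ _) hq1
    (fun k => le_max_of_le_right (by gcongr; exact (hβ k).1))
    (by simpa using (hαto.mul_const μ).mul_const s)
    ((hβ0.mul_const (1 - μ)).mul_const s)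
    (by rw [funext hy0]; exact contDiff_const) hyrec xb
  have h1 := hlim.comp (hι.tendsto_atTop.prodMk hxb)
  have h2 : Tendsto (fun K => fderiv ℝ (fun x => F x (y (ι K) x)) (xK (ι K))) atTop (𝓝 0) := by
    rw [tendsto_zero_iff_norm_tendsto_zero]
    refine (hεto.comp hι.tendsto_atTop).congr fun K => ?_
    rw [Function.comp_apply, ← hstat (ι K), gradient, LinearIsometryEquiv.norm_map]
  rw [gradient, hL.fderiv, tendsto_nhds_unique h1 h2, map_zero]
end
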